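/- (Corollary 2, bound (cor003).) Assume all intensity functions are 1-periodic: a_{ij}(t+1) = a_{ij}(t) for all i, j, t. Let a = ∫_0^1 α(t) dt > 0, K = sup_{0≤s≤t≤s+1} ∫_s^t α(u) du, R = e^K, and F = ess sup_{t≥0} ‖f(t)‖_{1D} < ∞ where f(t) = (a_{10}(t), a_{20}(t), ...). Let π : [0,∞) → l¹ be a 1-periodic solution of the forward Kolmogorov system (the limiting periodic regime) and let p be the solution with p(0) = e_0. Then ‖π(t) − p(t)‖ ≤ (4FR/a)·e^{−at} for all t ≥ 0. -/

import Mathlib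

open MeasureTheory intervalIntegral Filter
open scoped Topology

noncomputable section

/-- `p : ℝ → ℕ → ℝ` is a solution of the forward Kolmogorov system `dp/dt = A(t)p(t)` with
transposed intensity matrix `a`: each `p t` (for `t ≥ 0`) is a stochastic vector, and the
integral form `p_i(t) = p_i(s) + ∫_s^t Σ_j a_{ij}(u) p_j(u) du` of the equations holds for
all `i ≥ 0` and `0 ≤ s ≤ t`. -/
def IsKolmogorovSolution (a : ℕ → ℕ → ℝ → ℝ) (p : ℝ → ℕ → ℝ) : Prop :=
  (∀ t : ℝ, 0 ≤ t → (∀ i, 0 ≤ p t i) ∧ HasSum (p t) 1) ∧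
  (∀ i : ℕ, ∀ s t : ℝ, 0 ≤ s → s ≤ t →
    p t i = p s i + ∫ u in s..t, ∑' j : ℕ, a i j u * p u j)

/-- The weighted norm `‖w‖_{1D} = Σ_{k≥1} d_k |Σ_{i≥k} w_i|` (the coordinate `w 0` is not
used, and `d k` only matters for `k ≥ 1`). -/
def norm1D (d : ℕ → ℝ) (w : ℕ → ℝ) : ℝ :=
  ∑' k : ℕ, d (k + 1) * |∑' i : ℕ, w (k + 1 + i)|

/-- Summability of the series defining `‖w‖_{1D}`, i.e. `‖w‖_{1D} < ∞`. -/
def Norm1DFinite (d : ℕ → ℝ) (w : ℕ → ℝ) : Prop :=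
  Summable (fun k : ℕ => d (k + 1) * |∑' i : ℕ, w (k + 1 + i)|)

/-- Entries `b_{ij}(t) = a_{ij}(t) − a_{i0}(t)` of the reduced matrix `B(t)` (for
`i, j ≥ 1`), with the convention `b_{k,0}(t) := 0`. -/
def bEntry (a : ℕ → ℕ → ℝ → ℝ) (i j : ℕ) (t : ℝ) : ℝ :=
  if j = 0 then 0 else a i j t - a i 0 t

/-- Entries `b*_{ij}(t) = (d_i/d_j) Σ_{k≥i} (b_{kj}(t) − b_{k,j−1}(t))` of `D B(t) D⁻¹`. -/
def bStar (d : ℕ → ℝ) (a : ℕ → ℕ → ℝ → ℝ) (i j : ℕ) (t : ℝ) : ℝ :=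
  (d i / d j) * ∑' k : ℕ, (bEntry a (i + k) j t - bEntry a (i + k) (j - 1) t)

/-- `α_i(t) = −Σ_{j≥1} b*_{ji}(t)`. -/
def alphaI (d : ℕ → ℝ) (a : ℕ → ℕ → ℝ → ℝ) (i : ℕ) (t : ℝ) : ℝ :=
  -∑' j : ℕ, bStar d a (j + 1) i t

/-- `α(t) = inf_{i≥1} α_i(t)`. -/
def alphaInf (d : ℕ → ℝ) (a : ℕ → ℕ → ℝ → ℝ) (t : ℝ) : ℝ :=
  ⨅ i : ℕ, alphaI d a (i + 1) t


lemma ac_exp_comp {f : ℝ → ℝ} {a b : ℝ} (hf : AbsolutelyContinuousOnInterval f a b) :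
    AbsolutelyContinuousOnInterval (fun x => Real.exp (f x)) a b := by
  obtain ⟨M, hM⟩ := hf.exists_bound
  have hM0 : 0 ≤ M := le_trans (norm_nonneg _) (hM a Set.left_mem_uIcc)
  rw [absolutelyContinuousOnInterval_iff] at hf ⊢
  have key : ∀ x y : ℝ, |x| ≤ M → |y| ≤ M →
      dist (Real.exp x) (Real.exp y) ≤ Real.exp M * dist x y := by
    intro x y hx hy
    have := Convex.norm_image_sub_le_of_norm_deriv_le (f := Real.exp) (s := Set.Icc (-M) M)
      (C := Real.exp M) (x := y) (y := x) (fun z _ => Real.differentiableAt_exp)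
      (fun z hz => by
        rw [Real.deriv_exp, Real.norm_eq_abs, abs_of_pos (Real.exp_pos _)]
        exact Real.exp_le_exp.2 hz.2) (convex_Icc _ _) (abs_le.1 hy) (abs_le.1 hx)
    simpa [Real.dist_eq] using this
  intro ε hε
  obtain ⟨δ, hδ, h⟩ := hf (ε / Real.exp M) (by positivity)
  refine ⟨δ, hδ, fun E hE hE2 => ?_⟩
  have h3 := h E hE hE2
  have hE' := hE.1
  calc _ ≤ ∑ i ∈ Finset.range E.1, Real.exp M * dist (f (E.2 i).1) (f (E.2 i).2) := by
        apply Finset.sum_le_sum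
        intro i hi
        exact key _ _ (hM _ (hE' i hi).1) (hM _ (hE' i hi).2)
    _ = Real.exp M * ∑ i ∈ Finset.range E.1, dist (f (E.2 i).1) (f (E.2 i).2) := by
        rw [Finset.mul_sum]
    _ < ε := by
        rw [lt_div_iff₀ (Real.exp_pos M)] at h3
        linarith

lemma exp_mul_integral {α G ζ : ℝ → ℝ} {T : ℝ} (hT : 0 ≤ T)
    (hα : IntervalIntegrable α volume 0 T) (hG : IntervalIntegrable G volume 0 T)
    (hζ : ∀ t, 0 ≤ t → t ≤ T → ζ t = ζ 0 + ∫ u in (0:ℝ)..t, G u) :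
    Real.exp (∫ u in (0:ℝ)..T, α u) * ζ T
      = ζ 0 + ∫ s in (0:ℝ)..T, Real.exp (∫ u in (0:ℝ)..s, α u) * (G s + α s * ζ s) := by
  have hA := hα.absolutelyContinuousOnInterval_intervalIntegral (c := 0) (by simp)
  have hE := ac_exp_comp hA
  have hGA := hG.absolutelyContinuousOnInterval_intervalIntegral (c := 0) (by simp)
  have hc : AbsolutelyContinuousOnInterval (fun _ : ℝ => ζ 0) 0 T :=
    ((LipschitzWith.const (ζ 0)).lipschitzOnWith (s := Set.uIcc 0 T)).absolutelyContinuousOnInterval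
  have hZ := hc.add hGA
  have h := hE.integral_deriv_mul_eq_sub hZ
  have e1 : ∫ s in (0:ℝ)..T, Real.exp (∫ u in (0:ℝ)..s, α u) * (G s + α s * ζ s) =
      ∫ x in (0:ℝ)..T, deriv (fun x => Real.exp (∫ u in (0:ℝ)..x, α u)) x *
        ((fun _ : ℝ => ζ 0) + fun x => ∫ v in (0:ℝ)..x, G v) x
        + Real.exp (∫ u in (0:ℝ)..x, α u) *
          deriv ((fun _ : ℝ => ζ 0) + fun x => ∫ v in (0:ℝ)..x, G v) x := by
    apply intervalIntegral.integral_congr_ae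
    filter_upwards [hα.ae_hasDerivAt_integral, hG.ae_hasDerivAt_integral] with x h1 h2 hx
    have hx' := Set.uIoc_subset_uIcc hx
    have d1 := (h1 hx' 0 (by simp)).exp.deriv
    have d2 := ((hasDerivAt_const x (ζ 0)).add (h2 hx' 0 (by simp))).deriv
    rw [d1, d2]
    rw [Set.uIcc_of_le hT] at hx'
    simp only [Pi.add_apply]
    rw [← hζ x hx'.1 hx'.2]
    ring
  rw [e1, h]
  simp only [Pi.add_apply, integral_same, Real.exp_zero]
  rw [← hζ T hT le_rfl]
  ring

lemma ae_summable_of_integral {μ : Measure ℝ} {h : ℕ → ℝ → ℝ}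
    (hi : ∀ k, Integrable (h k) μ) (h0 : ∀ k, ∀ᵐ t ∂μ, 0 ≤ h k t)
    (hs : Summable (fun k => ∫ t, h k t ∂μ)) : ∀ᵐ t ∂μ, Summable (fun k => h k t) := by
  have h1 : ∫⁻ t, ∑' k, ENNReal.ofReal (h k t) ∂μ ≠ ⊤ := by
    rw [lintegral_tsum (fun k => (hi k).1.aemeasurable.ennreal_ofReal)]
    have : ∀ k, ∫⁻ t, ENNReal.ofReal (h k t) ∂μ = ENNReal.ofReal (∫ t, h k t ∂μ) := fun k =>
      (ofReal_integral_eq_lintegral_ofReal (hi k) (h0 k)).symm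
    simp_rw [this]
    exact hs.tsum_ofReal_ne_top
  have h2 := ae_lt_top' (AEMeasurable.tsum (fun k => (hi k).1.aemeasurable.ennreal_ofReal)) h1
  filter_upwards [h2, ae_all_iff.2 h0] with t ht h0t
  have := ENNReal.summable_toReal ht.ne
  refine this.congr (fun k => ?_)
  rw [ENNReal.toReal_ofReal (h0t k)]

structure GoodT (L : ℝ) (T : ℕ → ℕ → ℝ) : Prop where
  lo0 : ∀ k j, j < k → 0 ≤ T k j
  loL : ∀ k j, j < k → T k j ≤ L
  hi0 : ∀ k j, k ≤ j → T k j ≤ 0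
  hiL : ∀ k j, k ≤ j → -L ≤ T k j
  mono : ∀ k j, 1 ≤ k → j + 1 ≠ k → T k j ≤ T k (j + 1)

namespace GoodT
variable {L : ℝ} {T : ℕ → ℕ → ℝ}

lemma L0 (h : GoodT L T) : 0 ≤ L := (h.lo0 1 0 (by simp)).trans (h.loL 1 0 (by simp))

lemma abs_le (h : GoodT L T) (k j : ℕ) : |T k j| ≤ L := by
  have := h.L0
  rcases lt_or_ge j k with hj | hj
  · rw [abs_of_nonneg (h.lo0 k j hj)]; exact h.loL k j hj
  · rw [abs_of_nonpos (h.hi0 k j hj)]; linarith [h.hiL k j hj]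

lemma c_summable (h : GoodT L T) {k : ℕ} (hk : 1 ≤ k) :
    Summable (fun j => T k (j + 1) - T k j) := by
  rw [← summable_nat_add_iff k]
  refine summable_of_sum_range_le (c := 2 * L) (fun n => ?_) (fun n => ?_)
  · have := h.mono k (n + k) hk (by omega)
    linarith
  · have : ∑ i ∈ Finset.range n, (T k (i + k + 1) - T k (i + k)) = T k (n + k) - T k (0 + k) := by
      have := Finset.sum_range_sub (fun i => T k (i + k)) n
      rw [← this]
      refine Finset.sum_congr rfl fun i _ => ?_
      rw [show i + 1 + k = i + k + 1 by ring]
    rw [this]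
    have h2 := h.hiL k (0 + k) (by simp)
    have h3 := h.hi0 k (n + k) (by simp)
    have := h.L0
    linarith

lemma c_mul_summable (h : GoodT L T) {k : ℕ} (hk : 1 ≤ k) {x : ℕ → ℝ} (hx : ∀ j, |x j| ≤ 1) :
    Summable (fun j => (T k (j + 1) - T k j) * x (j + 1)) := by
  refine Summable.of_norm_bounded (h.c_summable hk).norm (fun j => ?_)
  rw [norm_mul]
  exact mul_le_of_le_one_right (norm_nonneg _) (hx _)

lemma mul_summable (h : GoodT L T) (k : ℕ) {q : ℕ → ℝ} (hq : Summable q) :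
    Summable (fun j => T k j * q j) := by
  refine Summable.of_norm_bounded (hq.norm.mul_left L) (fun j => ?_)
  rw [norm_mul]
  exact mul_le_mul_of_nonneg_right (h.abs_le k j) (norm_nonneg _)

lemma abel (h : GoodT L T) {k : ℕ} (hk : 1 ≤ k) {x q : ℕ → ℝ} (hx : ∀ j, |x j| ≤ 1)
    (hx0 : Tendsto x atTop (𝓝 0)) (hq : Summable q) (hqx : ∀ j, q j = x j - x (j + 1)) :
    ∑' j, T k j * q j = T k 0 * x 0 + ∑' j, (T k (j + 1) - T k j) * x (j + 1) := by
  have h1 := (h.mul_summable k hq).hasSum.tendsto_sum_nat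
  have h2 := (h.c_mul_summable hk hx).hasSum.tendsto_sum_nat
  have h3 : Tendsto (fun n => T k n * x n) atTop (𝓝 0) := by
    have h4 : Tendsto (fun n => L * |x n|) atTop (𝓝 0) := by
      simpa using (hx0.abs).const_mul L
    refine squeeze_zero_norm (fun n => ?_) h4
    rw [norm_mul]
    exact mul_le_mul_of_nonneg_right (h.abs_le k n) (norm_nonneg _)
  have h5 : ∀ n, ∑ j ∈ Finset.range n, T k j * q j =
      T k 0 * x 0 + ∑ j ∈ Finset.range n, (T k (j + 1) - T k j) * x (j + 1) - T k n * x n := by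
    intro n
    induction n with
    | zero => simp
    | succ n ih =>
      rw [Finset.sum_range_succ, Finset.sum_range_succ, ih, hqx]
      ring
  have h6 := ((tendsto_const_nhds (x := T k 0 * x 0)).add h2).sub h3
  rw [sub_zero] at h6
  refine tendsto_nhds_unique h1 (h6.congr (fun n => (h5 n).symm))

lemma lower (h : GoodT L T) (k : ℕ) {q : ℕ → ℝ} (hq0 : ∀ j, 0 ≤ q j) (hq : HasSum q 1) :
    ∑ j ∈ Finset.range k, T k j * q j - L * (1 - ∑ j ∈ Finset.range k, q j)
      ≤ ∑' j, T k j * q j := by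
  rw [← (h.mul_summable k hq.summable).sum_add_tsum_nat_add k]
  have h1 := hq.summable.sum_add_tsum_nat_add k
  rw [hq.tsum_eq] at h1
  have h2 : 1 - ∑ j ∈ Finset.range k, q j = ∑' j, q (j + k) := by linarith
  rw [h2, ← tsum_mul_left, sub_eq_add_neg, ← tsum_neg]
  refine add_le_add le_rfl (Summable.tsum_le_tsum (fun j => ?_)
    (((summable_nat_add_iff k).2 hq.summable).mul_left L).neg
    ((summable_nat_add_iff k).2 (h.mul_summable k hq.summable)))
  have := mul_le_mul_of_nonneg_right (h.hiL k (j + k) (by simp)) (hq0 (j + k))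
  linarith

lemma mono' (h : GoodT L T) {k i j : ℕ} (hk : 1 ≤ k) (hij : i ≤ j) (hj : j < k) :
    T k i ≤ T k j := by
  induction j, hij using Nat.le_induction with
  | base => exact le_rfl
  | succ j hij ih => exact (ih (by omega)).trans (h.mono k j hk (by omega))

lemma col_summable (h : GoodT L T) {d : ℕ → ℝ} (hd : ∀ k, 0 < d (k + 1)) {q : ℕ → ℝ}
    (hq0 : ∀ j, 0 ≤ q j)
    (hs : Summable (fun k => d (k + 1) * ∑ j ∈ Finset.range (k + 1), T (k + 1) j * q j))
    {i j : ℕ} (hij : i ≤ j) (hj : 0 < q j) : Summable (fun k => d (k + 1) * T (k + 1) i) := by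
  rw [← summable_nat_add_iff j] at hs ⊢
  refine Summable.of_nonneg_of_le (fun k => ?_) (fun k => ?_) (hs.mul_left (q j)⁻¹)
  · exact mul_nonneg (hd _).le (h.lo0 _ _ (by omega))
  · rw [inv_mul_eq_div, le_div_iff₀ hj, mul_assoc]
    refine mul_le_mul_of_nonneg_left ?_ (hd _).le
    calc T (k + j + 1) i * q j ≤ T (k + j + 1) j * q j :=
          mul_le_mul_of_nonneg_right (h.mono' (by omega) hij (by omega)) hj.le
      _ ≤ _ := Finset.single_le_sum (f := fun m => T (k + j + 1) m * q m)
          (fun m hm => mul_nonneg (h.lo0 _ _ (Finset.mem_range.1 hm)) (hq0 m))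
          (Finset.mem_range.2 (by omega))

lemma core (h : GoodT L T) {d : ℕ → ℝ} (hd : ∀ k, 0 < d (k + 1)) {ζ : ℕ → ℝ} {α : ℝ}
    (hζ0 : ∀ i, 0 ≤ ζ i) (hζ1 : ∀ i, ζ i ≤ 1)
    (hu : Summable (fun i => d (i + 1) * ζ (i + 1)))
    (hcol : ∀ i, 0 < ζ (i + 1) →
      Summable (fun k => d (k + 1) / d (i + 1) * (T (k + 1) (i + 1) - T (k + 1) i)))
    (hα : ∀ i, α ≤ -∑' k, d (k + 1) / d (i + 1) * (T (k + 1) (i + 1) - T (k + 1) i)) (n : ℕ) :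
    ∑ k ∈ Finset.range n, d (k + 1) * ∑' i, (T (k + 1) (i + 1) - T (k + 1) i) * ζ (i + 1)
      + α * ∑ k ∈ Finset.range n, d (k + 1) * ζ (k + 1)
      ≤ (2 * L + |α|) * ∑' i, d (i + n + 1) * ζ (i + n + 1) := by
  have hL := h.L0
  have habs : ∀ i, |ζ i| ≤ 1 := fun i => by rw [abs_of_nonneg (hζ0 i)]; exact hζ1 i
  set u : ℕ → ℝ := fun i => d (i + 1) * ζ (i + 1) with hudef
  have hu0 : ∀ i, 0 ≤ u i := fun i => mul_nonneg (hd i).le (hζ0 _)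
  set β : ℕ → ℕ → ℝ := fun k i => d (k + 1) / d (i + 1) * (T (k + 1) (i + 1) - T (k + 1) i)
    with hβ
  have hβ0 : ∀ k i, k ≠ i → 0 ≤ β k i := by
    intro k i hki
    refine mul_nonneg (div_nonneg (hd _).le (hd _).le) ?_
    have := h.mono (k + 1) i (by omega) (by omega)
    linarith
  have hβd : ∀ i, -(2 * L) ≤ β i i := by
    intro i
    simp only [hβ, div_self (hd i).ne', one_mul]
    have h1 := h.hiL (i + 1) (i + 1) le_rfl
    have h2 := h.loL (i + 1) i (by omega)
    linarith
  have hsum1 : ∀ k, Summable (fun i => d (k + 1) * ((T (k + 1) (i + 1) - T (k + 1) i) * ζ (i + 1))) :=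
    fun k => (h.c_mul_summable (by omega) habs).mul_left _
  have hterm : ∀ k i, d (k + 1) * ((T (k + 1) (i + 1) - T (k + 1) i) * ζ (i + 1)) = β k i * u i := by
    intro k i
    simp only [hβ, hudef]
    have := (hd i).ne'
    field_simp
  simp_rw [hterm] at hsum1
  have e1 : ∑ k ∈ Finset.range n, d (k + 1) * ∑' i, (T (k + 1) (i + 1) - T (k + 1) i) * ζ (i + 1)
      = ∑' i, (∑ k ∈ Finset.range n, β k i) * u i := by
    simp_rw [← tsum_mul_left, hterm, Finset.sum_mul]
    rw [Summable.tsum_finsetSum (fun k _ => hsum1 k)]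
  have hs2 : Summable (fun i => (∑ k ∈ Finset.range n, β k i) * u i) := by
    simp_rw [Finset.sum_mul]
    exact summable_sum (fun k _ => hsum1 k)
  have hbound : ∀ i, (∑ k ∈ Finset.range n, β k i) * u i ≤
      -α * u i + (if i < n then 0 else 2 * L * u i) := by
    intro i
    rcases (hζ0 (i + 1)).eq_or_lt with h0 | hpos
    · have : u i = 0 := by simp [hudef, ← h0]
      simp [this]
    · have hc : Summable (fun k => β k i) := hcol i hpos
      have ha : ∑' k, β k i ≤ -α := by linarith [hα i]
      split_ifs with hin
      · rw [add_zero]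
        refine mul_le_mul_of_nonneg_right (le_trans ?_ ha) (hu0 i)
        exact hc.sum_le_tsum _ (fun k hk => hβ0 k i (by
          rintro rfl; exact hk (Finset.mem_range.2 hin)))
      · rw [← add_mul]
        refine mul_le_mul_of_nonneg_right ?_ (hu0 i)
        have := hc.sum_le_tsum (insert i (Finset.range n)) (fun k hk => hβ0 k i (by
          rintro rfl; exact hk (Finset.mem_insert_self _ _)))
        rw [Finset.sum_insert (by simpa using hin)] at this
        linarith [hβd i]
  have hs3 : Summable (fun i => if i < n then 0 else 2 * L * u i) := by
    refine Summable.of_nonneg_of_le (fun i => ?_) (fun i => ?_) (hu.mul_left (2 * L))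
    · split_ifs
      · exact le_rfl
      · exact mul_nonneg (by linarith) (hu0 i)
    · split_ifs
      · exact mul_nonneg (by linarith) (hu0 i)
      · exact le_rfl
  have hle := hs2.tsum_le_tsum hbound ((hu.mul_left (-α)).add hs3)
  rw [(hu.mul_left (-α)).tsum_add hs3, tsum_mul_left, ← hs3.sum_add_tsum_nat_add n,
    ← hu.sum_add_tsum_nat_add n] at hle
  have e2 : ∑ i ∈ Finset.range n, (if i < n then 0 else 2 * L * u i) = 0 :=
    Finset.sum_eq_zero (fun i hi => by simp [Finset.mem_range.1 hi])
  have e3 : ∑' i, (if i + n < n then 0 else 2 * L * u (i + n)) = 2 * L * ∑' i, u (i + n) := by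
    rw [← tsum_mul_left]
    refine tsum_congr fun i => ?_
    simp
  rw [e2, e3, ← e1] at hle
  have hr : 0 ≤ ∑' i, u (i + n) := tsum_nonneg fun i => hu0 _
  have h7 := mul_le_mul_of_nonneg_right (neg_le_abs α) hr
  have e4 : ∑' i, d (i + n + 1) * ζ (i + n + 1) = ∑' i, u (i + n) := rfl
  rw [e4]
  change _ + α * ∑ k ∈ Finset.range n, u k ≤ _
  linarith

end GoodT

def Tm (a : ℕ → ℕ → ℝ → ℝ) (k j : ℕ) (t : ℝ) : ℝ := -∑ i ∈ Finset.range k, a i j t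
def tl (p : ℝ → ℕ → ℝ) (k : ℕ) (t : ℝ) : ℝ := 1 - ∑ i ∈ Finset.range k, p t i
def Gf (a : ℕ → ℕ → ℝ → ℝ) (p : ℝ → ℕ → ℝ) (k : ℕ) (t : ℝ) : ℝ := ∑' j, Tm a k j t * p t j

lemma Tm_eq {a : ℕ → ℕ → ℝ → ℝ} {t : ℝ} {j : ℕ} (h : HasSum (fun i => a i j t) 0) (k : ℕ) :
    HasSum (fun m => a (k + m) j t) (Tm a k j t) := by
  have h1 := (hasSum_nat_add_iff' k).2 h
  simp_rw [add_comm k]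
  simpa [Tm] using h1

lemma bStar_eq {d : ℕ → ℝ} {a : ℕ → ℕ → ℝ → ℝ} {t : ℝ}
    (h : ∀ j, HasSum (fun i => a i j t) 0) (k j : ℕ) :
    bStar d a k (j + 1) t = d k / d (j + 1) * (Tm a k (j + 1) t - Tm a k j t) := by
  unfold bStar
  congr 1
  rw [← ((Tm_eq (h (j + 1)) k).sub (Tm_eq (h j) k)).tsum_eq]
  refine tsum_congr fun m => ?_
  rcases j with _ | j <;> simp [bEntry]

lemma alphaI_eq {d : ℕ → ℝ} {a : ℕ → ℕ → ℝ → ℝ} {t : ℝ}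
    (h : ∀ j, HasSum (fun i => a i j t) 0) (i : ℕ) :
    alphaI d a (i + 1) t =
      -∑' k, d (k + 1) / d (i + 1) * (Tm a (k + 1) (i + 1) t - Tm a (k + 1) i t) := by
  unfold alphaI
  simp_rw [bStar_eq h]

lemma a_abs {a : ℕ → ℕ → ℝ → ℝ} {t L : ℝ} (h : ∀ j, HasSum (fun i => a i j t) 0)
    (hoff : ∀ i j, i ≠ j → 0 ≤ a i j t) (hL : ∀ j, |a j j t| ≤ L) (i j : ℕ) : |a i j t| ≤ L := by
  by_cases hij : i = j
  · subst hij; exact hL i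
  · rw [abs_of_nonneg (hoff i j hij)]
    have := sum_le_hasSum {i, j} (fun m hm => hoff m j (by
      rintro rfl; simp at hm)) (h j)
    rw [Finset.sum_pair hij] at this
    linarith [neg_abs_le (a j j t), hL j]

lemma goodT_of {d : ℕ → ℝ} {a : ℕ → ℕ → ℝ → ℝ} {t L : ℝ} (hd : ∀ k, 1 ≤ k → 0 < d k)
    (h : ∀ j, HasSum (fun i => a i j t) 0)
    (hoff : ∀ i j, i ≠ j → 0 ≤ a i j t) (hL : ∀ j, |a j j t| ≤ L)
    (hb : ∀ i j, 1 ≤ i → 1 ≤ j → i ≠ j → 0 ≤ bStar d a i j t) :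
    GoodT L (fun k j => Tm a k j t) where
  lo0 k j hj := (Tm_eq (h j) k).nonneg (fun m => hoff _ _ (by omega))
  loL k j hj := by
    unfold Tm
    have h1 : a j j t ≤ ∑ i ∈ Finset.range k, a i j t := by
      rw [← Finset.add_sum_erase _ _ (Finset.mem_range.2 hj)]
      have := Finset.sum_nonneg (s := (Finset.range k).erase j) (f := fun i => a i j t)
        (fun i hi => hoff i j (Finset.ne_of_mem_erase hi))
      linarith
    linarith [neg_abs_le (a j j t), hL j]
  hi0 k j hj := by
    unfold Tm
    have := Finset.sum_nonneg (s := (Finset.range k)) (f := fun i => a i j t)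
        (fun i hi => hoff i j (by have := Finset.mem_range.1 hi; omega))
    linarith
  hiL k j hj := by
    unfold Tm
    have := sum_le_hasSum (insert j (Finset.range k)) (fun m hm => hoff m j (by
      rintro rfl; simp at hm)) (h j)
    rw [Finset.sum_insert (by simpa using hj)] at this
    linarith [neg_abs_le (a j j t), hL j]
  mono k j hk hj := by
    have h1 := hb k (j + 1) hk (by omega) (by omega)
    rw [bStar_eq h] at h1
    have h2 : 0 < d k / d (j + 1) := div_pos (hd k hk) (hd _ (by omega))
    have := nonneg_of_mul_nonneg_right h1 h2
    linarith

/-- facts about stochastic vectors and tails -/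
lemma tl_props {p : ℝ → ℕ → ℝ} {t : ℝ} (h0 : ∀ i, 0 ≤ p t i) (h1 : HasSum (p t) 1) :
    (∀ k, 0 ≤ tl p k t) ∧ (∀ k, tl p k t ≤ 1) ∧ Tendsto (fun k => tl p k t) atTop (𝓝 0) ∧
    (∀ k, p t k = tl p k t - tl p (k + 1) t) ∧ tl p 0 t = 1 ∧
    (∀ k, HasSum (fun i => p t (i + k)) (tl p k t)) := by
  refine ⟨fun k => ?_, fun k => ?_, ?_, fun k => ?_, ?_, fun k => ?_⟩
  · unfold tl
    have := sum_le_hasSum (Finset.range k) (fun i _ => h0 i) h1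
    linarith
  · unfold tl
    have := Finset.sum_nonneg (s := Finset.range k) (fun i _ => h0 i)
    linarith
  · unfold tl
    simpa using h1.tendsto_sum_nat.const_sub 1
  · unfold tl
    rw [Finset.sum_range_succ]; ring
  · simp [tl]
  · exact (hasSum_nat_add_iff' k).2 h1

section sol
variable {a : ℕ → ℕ → ℝ → ℝ} {L : ℝ} {p : ℝ → ℕ → ℝ}

lemma tsum_bound {c q : ℕ → ℝ} {L : ℝ} (hc : ∀ j, |c j| ≤ L) (h0 : ∀ i, 0 ≤ q i) (h1 : HasSum q 1) :
    Summable (fun j => c j * q j) ∧ |∑' j, c j * q j| ≤ L := by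
  have h2 : ∀ j, ‖c j * q j‖ ≤ L * q j := fun j => by
    rw [norm_mul, Real.norm_of_nonneg (h0 j)]
    exact mul_le_mul_of_nonneg_right (hc j) (h0 j)
  have h3 := h1.mul_left L
  refine ⟨Summable.of_norm_bounded h3.summable h2, ?_⟩
  have := tsum_of_norm_bounded h3 h2
  simpa using this

lemma sol_cont (hp : IsKolmogorovSolution a p)
    (hA : ∀ᵐ t : ℝ, 0 ≤ t → ∀ i j, |a i j t| ≤ L) (i : ℕ) :
    ContinuousOn (fun t => p t i) (Set.Ici 0) := by
  have hL : 0 ≤ L := by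
    have : ∃ᵐ t : ℝ, t ∈ Set.Ici (0:ℝ) := by
      rw [frequently_ae_mem_iff]; simp
    obtain ⟨t, h1, h2⟩ := (this.and_eventually hA).exists
    exact (abs_nonneg _).trans (h2 h1 0 0)
  have key : ∀ s t : ℝ, 0 ≤ s → s ≤ t → |p t i - p s i| ≤ L * |t - s| := by
    intro s t hs hst
    rw [hp.2 i s t hs hst, add_sub_cancel_left, ← Real.norm_eq_abs]
    apply intervalIntegral.norm_integral_le_of_norm_le_const_ae
    filter_upwards [hA] with u hu hmem
    rw [Set.uIoc_of_le hst] at hmem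
    have hu0 : 0 ≤ u := hs.trans hmem.1.le
    exact (tsum_bound (hu hu0 i) (hp.1 u hu0).1 (hp.1 u hu0).2).2
  have : LipschitzOnWith ⟨L, hL⟩ (fun t => p t i) (Set.Ici 0) := by
    apply LipschitzOnWith.of_dist_le_mul
    intro x hx y hy
    rw [Real.dist_eq, Real.dist_eq]
    rcases le_total x y with h | h
    · rw [abs_sub_comm, abs_sub_comm x]; exact key x y hx h
    · exact key y x hy h
  exact this.continuousOn

lemma meas_mul (haloc : ∀ i j, LocallyIntegrableOn (a i j) (Set.Ici 0))
    (hc : ∀ i, ContinuousOn (fun t => p t i) (Set.Ici 0)) (k j : ℕ) :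
    AEMeasurable (fun u => Tm a k j u) (volume.restrict (Set.Ici 0)) ∧
    AEMeasurable (fun u => p u j) (volume.restrict (Set.Ici 0)) ∧
    AEMeasurable (fun u => Gf a p k u) (volume.restrict (Set.Ici 0)) := by
  have h1 : ∀ j, AEMeasurable (fun u => Tm a k j u) (volume.restrict (Set.Ici 0)) := fun j => by
    unfold Tm
    exact (Finset.aemeasurable_fun_sum _
      (fun i _ => (haloc i j).aestronglyMeasurable.aemeasurable)).neg
  have h2 : ∀ j, AEMeasurable (fun u => p u j) (volume.restrict (Set.Ici 0)) :=
    fun j => (hc j).aemeasurable measurableSet_Ici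
  exact ⟨h1 j, h2 j, AEMeasurable.tsum (fun j => (h1 j).mul (h2 j))⟩

lemma ii_of_bound {f : ℝ → ℝ} {C s t : ℝ} (hs : 0 ≤ s) (ht : 0 ≤ t)
    (hm : AEMeasurable f (volume.restrict (Set.Ici 0)))
    (hb : ∀ᵐ u : ℝ, 0 ≤ u → |f u| ≤ C) : IntervalIntegrable f volume s t := by
  have hsub : Set.uIoc s t ⊆ Set.Ici 0 := by
    intro x hx
    have := hx.1
    exact ((le_min hs ht).trans this.le)
  rw [intervalIntegrable_iff]
  refine Integrable.mono' (g := fun _ => C) ?_ (hm.mono_measure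
    (Measure.restrict_mono hsub le_rfl)).aestronglyMeasurable ?_
  · exact (intervalIntegrable_iff.1 (intervalIntegrable_const (a := s) (b := t) (c := C) (μ := volume)))
  · rw [ae_restrict_iff' measurableSet_uIoc]
    filter_upwards [hb] with u hu hmem
    exact hu (hsub hmem)

lemma Gf_bound (hp : IsKolmogorovSolution a p)
    (hT : ∀ᵐ t : ℝ, 0 ≤ t → GoodT L (fun k j => Tm a k j t)) (k : ℕ) :
    ∀ᵐ u : ℝ, 0 ≤ u → |Gf a p k u| ≤ L := by
  filter_upwards [hT] with u hu hu0
  exact (tsum_bound ((hu hu0).abs_le k) (hp.1 u hu0).1 (hp.1 u hu0).2).2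

lemma tl_int (hp : IsKolmogorovSolution a p)
    (haloc : ∀ i j, LocallyIntegrableOn (a i j) (Set.Ici 0))
    (hA : ∀ᵐ t : ℝ, 0 ≤ t → ∀ i j, |a i j t| ≤ L) (k : ℕ) {s t : ℝ} (hs : 0 ≤ s) (hst : s ≤ t) :
    tl p k t = tl p k s + ∫ u in s..t, Gf a p k u := by
  have hc := sol_cont hp hA
  have hg : ∀ i, IntervalIntegrable (fun u => ∑' j : ℕ, a i j u * p u j) volume s t := fun i => by
    refine ii_of_bound hs (hs.trans hst) (AEMeasurable.tsum (fun j =>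
      (haloc i j).aestronglyMeasurable.aemeasurable.mul ((hc j).aemeasurable measurableSet_Ici)))
      (C := L) ?_
    filter_upwards [hA] with u hu hu0
    exact (tsum_bound (hu hu0 i) (hp.1 u hu0).1 (hp.1 u hu0).2).2
  have e1 : ∫ u in s..t, Gf a p k u = ∫ u in s..t, -∑ i ∈ Finset.range k, ∑' j, a i j u * p u j := by
    apply intervalIntegral.integral_congr_ae
    filter_upwards [hA] with u hu hmem
    rw [Set.uIoc_of_le hst] at hmem
    have hu0 : 0 ≤ u := hs.trans hmem.1.le
    rw [← Summable.tsum_finsetSum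
      (fun i _ => (tsum_bound (hu hu0 i) (hp.1 u hu0).1 (hp.1 u hu0).2).1), ← tsum_neg]
    unfold Gf Tm
    refine tsum_congr fun j => ?_
    rw [neg_mul, Finset.sum_mul]
  rw [e1, intervalIntegral.integral_neg, intervalIntegral.integral_finsetSum (fun i _ => hg i)]
  unfold tl
  rw [Finset.sum_congr rfl (fun i _ => hp.2 i s t hs hst), Finset.sum_add_distrib]
  ring

end sol

lemma GoodT.comp {L : ℝ} {T : ℕ → ℕ → ℝ} (h : GoodT L T) {k : ℕ} (hk : 1 ≤ k) {v : ℕ → ℝ} {ψ : ℝ}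
    (hv : ∀ j, |v j| ≤ 1) (hψ : 0 ≤ ψ) (hvψ : ∀ j, v j ≤ ψ) :
    ∑' j, (T k (j + 1) - T k j) * v (j + 1) + 2 * L * v k ≤ 2 * L * ψ := by
  have hs := h.c_mul_summable hk hv
  have hc := h.c_summable hk
  have hc0 : ∑' j, (T k (j + 1) - T k j) ≤ 0 := by
    refine le_of_tendsto hc.hasSum.tendsto_sum_nat ?_
    filter_upwards [eventually_ge_atTop k] with n hn
    rw [Finset.sum_range_sub]
    linarith [h.hi0 k n hn, h.lo0 k 0 hk]
  have h1 : HasSum (fun j => if j = k - 1 then 2 * L * (ψ - v k) else 0) (2 * L * (ψ - v k)) :=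
    hasSum_ite_eq (k - 1) _
  have h2 := (hc.hasSum.mul_right ψ).sub hs.hasSum
  have h3 := (h2.add h1).nonneg (fun j => by
    split_ifs with hj
    · subst hj
      have e1 := h.hiL k (k - 1 + 1) (by omega)
      have e2 := h.loL k (k - 1) (by omega)
      have e3 := hvψ k
      rw [Nat.sub_add_cancel hk] at e1 ⊢
      nlinarith
    · have e1 := h.mono k j hk (by omega)
      have e3 := hvψ (j + 1)
      nlinarith)
  nlinarith [mul_nonneg hψ (sub_nonneg.2 hc0)]

lemma main_ineq {α : ℝ → ℝ} {ζ H : ℕ → ℝ → ℝ} {d : ℕ → ℝ} {F L C T : ℝ} (hT0 : 0 ≤ T) (hL : 0 ≤ L)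
    (hd : ∀ k, 0 < d (k + 1))
    (hα : IntervalIntegrable α volume 0 T)
    (hH : ∀ k, IntervalIntegrable (H k) volume 0 T)
    (hζ : ∀ k t, 0 ≤ t → t ≤ T → ζ k t = ζ k 0 + ∫ u in (0:ℝ)..t, H k u)
    (hζ0 : ∀ k t, 0 ≤ t → t ≤ T → 0 ≤ ζ k t)
    (hX : ∀ t, 0 ≤ t → t ≤ T → Summable (fun k => d (k + 1) * ζ (k + 1) t))
    (hC : ∀ t, 0 ≤ t → t ≤ T → ∑' k, d (k + 1) * ζ (k + 1) t ≤ C)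
    (hineq : ∀ᵐ t : ℝ, 0 ≤ t → t ≤ T → ∀ n,
      ∑ k ∈ Finset.range n, d (k + 1) * H (k + 1) t
        + α t * ∑ k ∈ Finset.range n, d (k + 1) * ζ (k + 1) t
      ≤ F + (2 * L + |α t|) * ∑' i, d (i + n + 1) * ζ (i + n + 1) t) :
    Real.exp (∫ u in (0:ℝ)..T, α u) * ∑' k, d (k + 1) * ζ (k + 1) T ≤
      ∑' k, d (k + 1) * ζ (k + 1) 0 + F * ∫ s in (0:ℝ)..T, Real.exp (∫ u in (0:ℝ)..s, α u) := by
  set E : ℝ → ℝ := fun s => Real.exp (∫ u in (0:ℝ)..s, α u) with hE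
  have hEc : ContinuousOn E (Set.uIcc 0 T) :=
    (ac_exp_comp (hα.absolutelyContinuousOnInterval_intervalIntegral (c := 0) (by simp))).continuousOn
  have hζc : ∀ k, ContinuousOn (ζ k) (Set.uIcc 0 T) := fun k => by
    have := ((hH k).absolutelyContinuousOnInterval_intervalIntegral (c := 0) (by simp)).continuousOn
    refine (continuousOn_const (c := ζ k 0)).add this |>.congr (fun t ht => ?_)
    rw [Set.uIcc_of_le hT0] at ht
    exact hζ k t ht.1 ht.2
  set r : ℕ → ℝ → ℝ := fun n t => ∑' i, d (i + n + 1) * ζ (i + n + 1) t with hr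
  have hu0 : ∀ k t, 0 ≤ t → t ≤ T → 0 ≤ d (k + 1) * ζ (k + 1) t := fun k t h1 h2 =>
    mul_nonneg (hd k).le (hζ0 _ t h1 h2)
  have hr0 : ∀ n t, 0 ≤ t → t ≤ T → 0 ≤ r n t := fun n t h1 h2 =>
    tsum_nonneg (fun i => hu0 _ t h1 h2)
  have hrC : ∀ n t, 0 ≤ t → t ≤ T → r n t ≤ C := fun n t h1 h2 => by
    have e1 := (hX t h1 h2).sum_add_tsum_nat_add n
    have e2 := Finset.sum_nonneg (s := Finset.range n) (fun i _ => hu0 i t h1 h2)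
    have e3 := hC t h1 h2
    simp only [hr]
    linarith
  have hrm : ∀ n, AEStronglyMeasurable (r n) (volume.restrict (Set.uIoc 0 T)) := fun n => by
    refine (AEMeasurable.tsum (fun i => ?_)).aestronglyMeasurable
    exact (((hζc (i + n + 1)).mono Set.uIoc_subset_uIcc).aemeasurable measurableSet_uIoc).const_mul _
  have hrt : ∀ t, 0 ≤ t → t ≤ T → Tendsto (fun n => r n t) atTop (𝓝 0) := fun t _ _ =>
    tendsto_sum_nat_add (fun k => d (k + 1) * ζ (k + 1) t)
  -- bounding function
  set W : ℝ → ℝ := fun s => E s * (2 * L + |α s|) with hW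
  have hWi : IntervalIntegrable W volume 0 T :=
    (intervalIntegrable_const.add hα.abs).continuousOn_mul hEc
  have hW0 : ∀ s, 0 ≤ W s := fun s => mul_nonneg (Real.exp_pos _).le (by positivity)
  have hWr : ∀ n, IntervalIntegrable (fun s => W s * r n s) volume 0 T := fun n => by
    have h1 := hWi.mul_const C
    rw [intervalIntegrable_iff] at h1 ⊢
    refine Integrable.mono' h1 ((intervalIntegrable_iff.1 hWi).1.mul (hrm n)) ?_
    rw [ae_restrict_iff' measurableSet_uIoc]
    refine Eventually.of_forall fun s hs => ?_
    rw [Set.uIoc_of_le hT0] at hs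
    rw [Real.norm_of_nonneg (mul_nonneg (hW0 s) (hr0 n s hs.1.le hs.2))]
    exact mul_le_mul_of_nonneg_left (hrC n s hs.1.le hs.2) (hW0 s)
  have hlim : Tendsto (fun n => ∫ s in (0:ℝ)..T, W s * r n s) atTop (𝓝 (∫ s in (0:ℝ)..T, (0:ℝ))) := by
    refine intervalIntegral.tendsto_integral_filter_of_dominated_convergence (fun s => W s * C)
      (Eventually.of_forall fun n => (intervalIntegrable_iff.1 (hWr n)).1)
      (Eventually.of_forall fun n => Eventually.of_forall fun s hs => ?_) (hWi.mul_const C)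
      (Eventually.of_forall fun s hs => ?_)
    · rw [Set.uIoc_of_le hT0] at hs
      rw [Real.norm_of_nonneg (mul_nonneg (hW0 s) (hr0 n s hs.1.le hs.2))]
      exact mul_le_mul_of_nonneg_left (hrC n s hs.1.le hs.2) (hW0 s)
    · rw [Set.uIoc_of_le hT0] at hs
      simpa using (hrt s hs.1.le hs.2).const_mul (W s)
  have hEF : IntervalIntegrable (fun s => E s * F) volume 0 T :=
    (intervalIntegrable_const).continuousOn_mul hEc
  have hstep : ∀ n, E T * ∑ k ∈ Finset.range n, d (k + 1) * ζ (k + 1) T ≤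
      ∑' k, d (k + 1) * ζ (k + 1) 0 + (F * ∫ s in (0:ℝ)..T, E s) + ∫ s in (0:ℝ)..T, W s * r n s := by
    intro n
    have hGi : IntervalIntegrable (fun s => ∑ k ∈ Finset.range n, d (k + 1) * H (k + 1) s) volume 0 T :=
      by
        have := IntervalIntegrable.sum (Finset.range n)
          (f := fun k s => d (k + 1) * H (k + 1) s) (μ := volume) (a := 0) (b := T)
          (fun k _ => (hH (k + 1)).const_mul _)
        have e : (fun s => ∑ k ∈ Finset.range n, d (k + 1) * H (k + 1) s) =
            ∑ k ∈ Finset.range n, (fun s => d (k + 1) * H (k + 1) s) := by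
          ext s; simp
        rw [e]; exact this
    have hUc : ContinuousOn (fun s => ∑ k ∈ Finset.range n, d (k + 1) * ζ (k + 1) s) (Set.uIcc 0 T) :=
      continuousOn_finsetSum _ (fun k _ => continuousOn_const.mul (hζc (k + 1)))
    have h1 := exp_mul_integral (ζ := fun s => ∑ k ∈ Finset.range n, d (k + 1) * ζ (k + 1) s)
      hT0 hα hGi (fun t h0 h1 => by
        rw [intervalIntegral.integral_finsetSum, ← Finset.sum_add_distrib]
        · refine Finset.sum_congr rfl fun k _ => ?_
          rw [intervalIntegral.integral_const_mul, ← mul_add, ← hζ (k + 1) t h0 h1]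
        · intro k _
          refine ((hH (k + 1)).mono_set ?_).const_mul _
          rw [Set.uIcc_of_le h0, Set.uIcc_of_le hT0]
          exact Set.Icc_subset_Icc le_rfl h1)
    simp only [hE]
    rw [h1, add_assoc]
    refine add_le_add ((hX 0 le_rfl hT0).sum_le_tsum _ (fun k _ => hu0 k 0 le_rfl hT0)) ?_
    have e1 : (F * ∫ s in (0:ℝ)..T, E s) = ∫ s in (0:ℝ)..T, E s * F := by
      rw [intervalIntegral.integral_mul_const, mul_comm]
    simp only [hE] at e1
    rw [e1, ← intervalIntegral.integral_add hEF (hWr n)]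
    refine intervalIntegral.integral_mono_ae_restrict hT0
      ((hGi.add (hα.mul_continuousOn hUc)).continuousOn_mul hEc) (hEF.add (hWr n)) ?_
    unfold EventuallyLE
    rw [ae_restrict_iff' measurableSet_Icc]
    filter_upwards [hineq] with s hs hmem
    have := mul_le_mul_of_nonneg_left (hs hmem.1 hmem.2 n) (Real.exp_pos (∫ u in (0:ℝ)..s, α u)).le
    simp only [hW, hE, hr]
    linarith
  have hl1 := ((hX T hT0 le_rfl).hasSum.tendsto_sum_nat).const_mul (E T)
  have hl2 := hlim.const_add (∑' k, d (k + 1) * ζ (k + 1) 0 + (F * ∫ s in (0:ℝ)..T, E s))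
  have := le_of_tendsto_of_tendsto' hl1 hl2 hstep
  simpa using this

section sol2
variable {a : ℕ → ℕ → ℝ → ℝ} {L : ℝ} {p π : ℝ → ℕ → ℝ}

lemma Gf_ii (hp : IsKolmogorovSolution a p)
    (haloc : ∀ i j, LocallyIntegrableOn (a i j) (Set.Ici 0))
    (hA : ∀ᵐ t : ℝ, 0 ≤ t → ∀ i j, |a i j t| ≤ L)
    (hT : ∀ᵐ t : ℝ, 0 ≤ t → GoodT L (fun k j => Tm a k j t)) (k : ℕ) {s t : ℝ}
    (hs : 0 ≤ s) (ht : 0 ≤ t) : IntervalIntegrable (Gf a p k) volume s t :=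
  ii_of_bound hs ht (meas_mul haloc (sol_cont hp hA) k 0).2.2 (Gf_bound hp hT k)

lemma tl_cont (hp : IsKolmogorovSolution a p)
    (hA : ∀ᵐ t : ℝ, 0 ≤ t → ∀ i j, |a i j t| ≤ L) (k : ℕ) :
    ContinuousOn (tl p k) (Set.Ici 0) := by
  unfold tl
  exact continuousOn_const.sub (continuousOn_finsetSum _ (fun i _ => sol_cont hp hA i))

lemma tl_exp (hp : IsKolmogorovSolution a p)
    (haloc : ∀ i j, LocallyIntegrableOn (a i j) (Set.Ici 0))
    (hA : ∀ᵐ t : ℝ, 0 ≤ t → ∀ i j, |a i j t| ≤ L)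
    (hT : ∀ᵐ t : ℝ, 0 ≤ t → GoodT L (fun k j => Tm a k j t)) (k : ℕ) {s t : ℝ}
    (hs : 0 ≤ s) (hst : s ≤ t) :
    IntervalIntegrable (fun u => Real.exp (L * u) * (Gf a p k u + L * tl p k u)) volume s t ∧
    Real.exp (L * t) * tl p k t = Real.exp (L * s) * tl p k s +
      ∫ u in s..t, Real.exp (L * u) * (Gf a p k u + L * tl p k u) := by
  have h1 : ∀ r, 0 ≤ r → Real.exp (L * r) * tl p k r = tl p k 0 +
      ∫ u in (0:ℝ)..r, Real.exp (L * u) * (Gf a p k u + L * tl p k u) := fun r hr => by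
    have := exp_mul_integral (α := fun _ => L) (ζ := tl p k) hr intervalIntegrable_const
      (Gf_ii hp haloc hA hT k le_rfl hr) (fun t h0 _ => tl_int hp haloc hA k le_rfl h0)
    simpa [mul_comm] using this
  have hi : ∀ r q, 0 ≤ r → 0 ≤ q → IntervalIntegrable
      (fun u => Real.exp (L * u) * (Gf a p k u + L * tl p k u)) volume r q := fun r q hr hq => by
    have hsub : Set.uIcc r q ⊆ Set.Ici 0 := fun x hx => (le_min hr hq).trans hx.1
    exact ((Gf_ii hp haloc hA hT k hr hq).add
      ((((tl_cont hp hA k).mono hsub).intervalIntegrable).const_mul L)).continuousOn_mul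
      (by fun_prop)
  refine ⟨hi s t hs (hs.trans hst), ?_⟩
  have h2 := intervalIntegral.integral_add_adjacent_intervals (hi 0 s le_rfl hs)
    (hi s t hs (hs.trans hst))
  rw [h1 t (hs.trans hst), h1 s hs, ← h2]
  ring

lemma tl_grow (hp : IsKolmogorovSolution a p)
    (haloc : ∀ i j, LocallyIntegrableOn (a i j) (Set.Ici 0))
    (hA : ∀ᵐ t : ℝ, 0 ≤ t → ∀ i j, |a i j t| ≤ L)
    (hT : ∀ᵐ t : ℝ, 0 ≤ t → GoodT L (fun k j => Tm a k j t)) (k : ℕ) {s t : ℝ}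
    (hs : 0 ≤ s) (hst : s ≤ t) : tl p k s ≤ Real.exp (L * (t - s)) * tl p k t := by
  have h1 := (tl_exp hp haloc hA hT k hs hst).2
  have h2 : 0 ≤ ∫ u in s..t, Real.exp (L * u) * (Gf a p k u + L * tl p k u) := by
    refine intervalIntegral.integral_nonneg_of_ae_restrict hst ?_
    unfold EventuallyLE
    rw [ae_restrict_iff' measurableSet_Icc]
    filter_upwards [hT] with u hu hmem
    have hu0 := hs.trans hmem.1
    refine mul_nonneg (Real.exp_pos _).le ?_
    have := (hu hu0).lower k (hp.1 u hu0).1 (hp.1 u hu0).2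
    have h3 := Finset.sum_nonneg (s := Finset.range k) (f := fun j => Tm a k j u * p u j)
      (fun j hj => mul_nonneg ((hu hu0).lo0 k j (Finset.mem_range.1 hj)) ((hp.1 u hu0).1 j))
    unfold Gf tl
    linarith
  have h3 : Real.exp (L * (t - s)) = Real.exp (L * t) / Real.exp (L * s) := by
    rw [← Real.exp_sub]; ring_nf
  rw [h3, div_mul_eq_mul_div, le_div_iff₀ (Real.exp_pos _)]
  linarith

lemma col_ae {d : ℕ → ℝ} (hd : ∀ k, 0 < d (k + 1)) (hp : IsKolmogorovSolution a p)
    (haloc : ∀ i j, LocallyIntegrableOn (a i j) (Set.Ici 0))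
    (hA : ∀ᵐ t : ℝ, 0 ≤ t → ∀ i j, |a i j t| ≤ L)
    (hT : ∀ᵐ t : ℝ, 0 ≤ t → GoodT L (fun k j => Tm a k j t))
    (hfin : ∀ n : ℕ, Summable (fun k => d (k + 1) * tl p (k + 1) n)) :
    ∀ᵐ t : ℝ, 0 ≤ t → Summable (fun k => d (k + 1) *
      ∑ j ∈ Finset.range (k + 1), Tm a (k + 1) j t * p t j) := by
  have hL : 0 ≤ L := by
    have : ∃ᵐ t : ℝ, t ∈ Set.Ici (0:ℝ) := by
      rw [frequently_ae_mem_iff]; simp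
    obtain ⟨t, h1, h2⟩ := (this.and_eventually hA).exists
    exact (abs_nonneg _).trans (h2 h1 0 0)
  have hm := meas_mul (p := p) haloc (sol_cont hp hA)
  have h0 : ∀ k, ∀ᵐ t : ℝ, 0 ≤ t →
      0 ≤ ∑ j ∈ Finset.range (k + 1), Tm a (k + 1) j t * p t j := fun k => by
    filter_upwards [hT] with u hu hu0
    exact Finset.sum_nonneg
      (fun j hj => mul_nonneg ((hu hu0).lo0 _ j (Finset.mem_range.1 hj)) ((hp.1 u hu0).1 j))
  have hlow : ∀ k, ∀ᵐ t : ℝ, 0 ≤ t → ∑ j ∈ Finset.range (k + 1), Tm a (k + 1) j t * p t j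
      ≤ Gf a p (k + 1) t + L * tl p (k + 1) t := fun k => by
    filter_upwards [hT] with u hu hu0
    have := (hu hu0).lower (k + 1) (hp.1 u hu0).1 (hp.1 u hu0).2
    unfold Gf tl
    linarith
  have hi : ∀ (n k : ℕ), IntervalIntegrable
      (fun t => ∑ j ∈ Finset.range (k + 1), Tm a (k + 1) j t * p t j) volume 0 n := fun n k => by
    refine ii_of_bound le_rfl (Nat.cast_nonneg n) (C := L + L) (Finset.aemeasurable_fun_sum _
      (fun j _ => (hm (k + 1) j).1.mul (hm (k + 1) j).2.1)) ?_
    filter_upwards [h0 k, hlow k, Gf_bound hp hT (k + 1)] with u h1 h2 h3 hu0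
    rw [abs_of_nonneg (h1 hu0)]
    have h4 := (tl_props (hp.1 u hu0).1 (hp.1 u hu0).2).2.1 (k + 1)
    have h5 := mul_le_mul_of_nonneg_left h4 hL
    linarith [h2 hu0, le_abs_self (Gf a p (k + 1) u), h3 hu0]
  have hn : ∀ n : ℕ, ∀ᵐ t ∂(volume.restrict (Set.Ioc (0:ℝ) n)), Summable (fun k => d (k + 1) *
      ∑ j ∈ Finset.range (k + 1), Tm a (k + 1) j t * p t j) := fun n => by
    have hn0 : (0:ℝ) ≤ n := Nat.cast_nonneg n
    have h0' : ∀ k, ∀ᵐ t ∂(volume.restrict (Set.Ioc (0:ℝ) n)), 0 ≤ d (k + 1) *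
      ∑ j ∈ Finset.range (k + 1), Tm a (k + 1) j t * p t j := fun k => by
      rw [ae_restrict_iff' measurableSet_Ioc]
      filter_upwards [h0 k] with u hu hmem
      exact mul_nonneg (hd k).le (hu hmem.1.le)
    refine ae_summable_of_integral (fun k => ?_) h0' ?_
    · exact ((intervalIntegrable_iff_integrableOn_Ioc_of_le hn0).1 (hi n k)).const_mul _
    · refine Summable.of_nonneg_of_le (fun k => integral_nonneg_of_ae (h0' k)) (fun k => ?_)
        ((hfin n).mul_left (Real.exp (L * n)))
      rw [← intervalIntegral.integral_of_le hn0, intervalIntegral.integral_const_mul]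
      obtain ⟨hii, heq⟩ := tl_exp hp haloc hA hT (k + 1) le_rfl hn0
      rw [mul_left_comm]
      refine mul_le_mul_of_nonneg_left ?_ (hd k).le
      rw [heq]
      have h6 := (tl_props (hp.1 0 le_rfl).1 (hp.1 0 le_rfl).2).1 (k + 1)
      have h7 : ∫ u in (0:ℝ)..n, ∑ j ∈ Finset.range (k + 1), Tm a (k + 1) j u * p u j ≤
          ∫ u in (0:ℝ)..n, Real.exp (L * u) * (Gf a p (k + 1) u + L * tl p (k + 1) u) := by
        refine intervalIntegral.integral_mono_ae_restrict hn0 (hi n k) hii ?_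
        unfold EventuallyLE
        rw [ae_restrict_iff' measurableSet_Icc]
        filter_upwards [h0 k, hlow k] with u h1 h2 hmem
        refine (h2 hmem.1).trans (le_mul_of_one_le_left ((h1 hmem.1).trans (h2 hmem.1)) ?_)
        exact Real.one_le_exp (mul_nonneg hL hmem.1)
      have := mul_nonneg (Real.exp_pos (L * 0)).le h6
      linarith
  have hne : ∀ᵐ t : ℝ, t ≠ 0 := by simp [ae_iff, measure_singleton]
  have hall : ∀ᵐ t : ℝ, ∀ n : ℕ, t ∈ Set.Ioc (0:ℝ) n → Summable (fun k => d (k + 1) *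
      ∑ j ∈ Finset.range (k + 1), Tm a (k + 1) j t * p t j) :=
    ae_all_iff.2 fun n => (ae_restrict_iff' measurableSet_Ioc).1 (hn n)
  filter_upwards [hne, hall] with t h1 h2 h3
  exact h2 ⌈t⌉₊ ⟨lt_of_le_of_ne h3 h1.symm, Nat.le_ceil t⟩

lemma abelG (hp : IsKolmogorovSolution a p) {t : ℝ} (ht : 0 ≤ t)
    (hT : GoodT L (fun k j => Tm a k j t)) {k : ℕ} (hk : 1 ≤ k) :
    Gf a p k t = Tm a k 0 t +
      ∑' j, (Tm a k (j + 1) t - Tm a k j t) * tl p (j + 1) t := by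
  obtain ⟨h1, h2, h3, h4, h5, -⟩ := tl_props (hp.1 t ht).1 (hp.1 t ht).2
  have := hT.abel hk (x := fun j => tl p j t) (q := p t)
    (fun j => by rw [abs_of_nonneg (h1 j)]; exact h2 j) h3 (hp.1 t ht).2.summable h4
  unfold Gf
  rw [this, h5, mul_one]

lemma abelG_sub (hp : IsKolmogorovSolution a p) (hπ : IsKolmogorovSolution a π) {t : ℝ} (ht : 0 ≤ t)
    (hT : GoodT L (fun k j => Tm a k j t)) {k : ℕ} (hk : 1 ≤ k) :
    Gf a p k t - Gf a π k t = 
      ∑' j, (Tm a k (j + 1) t - Tm a k j t) * (tl p (j + 1) t - tl π (j + 1) t) := by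
  rw [abelG hp ht hT hk, abelG hπ ht hT hk]
  have hs : ∀ {q : ℝ → ℕ → ℝ}, IsKolmogorovSolution a q →
      Summable (fun j => (Tm a k (j + 1) t - Tm a k j t) * tl q (j + 1) t) := fun {q} hq => by
    obtain ⟨h1, h2, -⟩ := tl_props (hq.1 t ht).1 (hq.1 t ht).2
    exact hT.c_mul_summable hk (x := fun j => tl q j t)
      (fun j => by rw [abs_of_nonneg (h1 j)]; exact h2 j)
  simp_rw [mul_sub]
  rw [(hs hp).tsum_sub (hs hπ)]
  ring

lemma compare (hp : IsKolmogorovSolution a p) (hπ : IsKolmogorovSolution a π)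
    (haloc : ∀ i j, LocallyIntegrableOn (a i j) (Set.Ici 0))
    (hA : ∀ᵐ t : ℝ, 0 ≤ t → ∀ i j, |a i j t| ≤ L)
    (hT : ∀ᵐ t : ℝ, 0 ≤ t → GoodT L (fun k j => Tm a k j t)) (hL : 0 ≤ L)
    (h0 : ∀ k, tl p k 0 ≤ tl π k 0) (k : ℕ) {T : ℝ} (hT0 : 0 ≤ T) : tl p k T ≤ tl π k T := by
  have hbd : ∀ t, 0 ≤ t → ∀ k, |tl p k t - tl π k t| ≤ 1 := fun t ht k => by
    obtain ⟨h1, h2, -⟩ := tl_props (hp.1 t ht).1 (hp.1 t ht).2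
    obtain ⟨h3, h4, -⟩ := tl_props (hπ.1 t ht).1 (hπ.1 t ht).2
    rw [abs_le]
    constructor <;> linarith [h1 k, h2 k, h3 k, h4 k]
  have hz : ∀ t, 0 ≤ t → tl p 0 t - tl π 0 t = 0 := fun t _ => by simp [tl]
  have claim : ∀ n : ℕ, ∀ k t, 0 ≤ t → t ≤ T → Real.exp (2 * L * t) * (tl p k t - tl π k t) ≤
      Real.exp (2 * L * T) * ((2 * L * t) ^ n / n.factorial) := by
    intro n
    induction n with
    | zero =>
      intro k t ht htT
      simp only [pow_zero, Nat.factorial_zero, Nat.cast_one, div_one]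
      exact (mul_le_mul_of_nonneg_left (le_of_abs_le (hbd t ht k)) (Real.exp_pos _).le).trans
        (mul_le_mul_of_nonneg_right (Real.exp_le_exp.2 (by gcongr)) zero_le_one)
    | succ n ih =>
      intro k t ht htT
      have hrhs : ∀ s, 0 ≤ s → ∀ n : ℕ,
          0 ≤ Real.exp (2 * L * T) * ((2 * L * s) ^ n / n.factorial) := fun s hs n => by positivity
      rcases Nat.eq_zero_or_pos k with rfl | hk
      · rw [hz t ht, mul_zero]; exact hrhs t ht (n + 1)
      have hG := (Gf_ii hp haloc hA hT k le_rfl ht).sub (Gf_ii hπ haloc hA hT k le_rfl ht)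
      have h1 := exp_mul_integral (α := fun _ => 2 * L) (ζ := fun t => tl p k t - tl π k t) ht
        intervalIntegrable_const hG (fun r hr _ => by
          rw [intervalIntegral.integral_sub (Gf_ii hp haloc hA hT k le_rfl hr)
            (Gf_ii hπ haloc hA hT k le_rfl hr), tl_int hp haloc hA k le_rfl hr,
            tl_int hπ haloc hA k le_rfl hr]
          ring)
      simp only [intervalIntegral.integral_const, sub_zero, smul_eq_mul, mul_comm _ (2 * L)] at h1
      rw [h1]
      have hsub : Set.uIcc 0 t ⊆ Set.Ici 0 := fun x hx => (le_min le_rfl ht).trans hx.1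
      have h2 : ∫ s in (0:ℝ)..t, Real.exp (2 * L * s) * (Gf a p k s - Gf a π k s +
          2 * L * (tl p k s - tl π k s)) ≤
          ∫ s in (0:ℝ)..t, (2 * L) * (Real.exp (2 * L * T) * ((2 * L * s) ^ n / n.factorial)) := by
        refine intervalIntegral.integral_mono_ae_restrict ht ?_ ?_ ?_
        · exact (hG.add (((((tl_cont hp hA k).sub (tl_cont hπ hA k)).mono
            hsub).intervalIntegrable).const_mul (2 * L))).continuousOn_mul (by fun_prop)
        · exact Continuous.intervalIntegrable (by fun_prop) _ _
        · unfold EventuallyLE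
          rw [ae_restrict_iff' measurableSet_Icc]
          filter_upwards [hT] with s hs hmem
          have hs0 := hmem.1
          rw [abelG_sub hp hπ hs0 (hs hs0) hk]
          have h3 := (hs hs0).comp hk (v := fun j => tl p j s - tl π j s)
            (ψ := (Real.exp (2 * L * s))⁻¹ *
              (Real.exp (2 * L * T) * ((2 * L * s) ^ n / n.factorial)))
            (hbd s hs0) (mul_nonneg (inv_nonneg.2 (Real.exp_pos _).le) (hrhs s hs0 n))
            (fun j => by
              rw [inv_mul_eq_div, le_div_iff₀ (Real.exp_pos _), mul_comm]
              exact ih j s hs0 (hmem.2.trans htT))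
          have h4 := mul_le_mul_of_nonneg_left h3 (Real.exp_pos (2 * L * s)).le
          refine h4.trans (le_of_eq ?_)
          have := (Real.exp_pos (2 * L * s)).ne'
          field_simp
      have h5 : ∫ s in (0:ℝ)..t, (2 * L) * (Real.exp (2 * L * T) * ((2 * L * s) ^ n / n.factorial))
          = Real.exp (2 * L * T) * ((2 * L * t) ^ (n + 1) / (n + 1).factorial) := by
        have : ∀ s : ℝ, (2 * L) * (Real.exp (2 * L * T) * ((2 * L * s) ^ n / n.factorial)) =
            ((2 * L) ^ (n + 1) * Real.exp (2 * L * T) / n.factorial) * s ^ n := fun s => by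
          rw [mul_pow]; ring
        simp_rw [this]
        rw [intervalIntegral.integral_const_mul, integral_pow, Nat.factorial_succ]
        push_cast
        have : (n.factorial : ℝ) ≠ 0 := by positivity
        have : (n + 1 : ℝ) ≠ 0 := by positivity
        field_simp
        ring
      have h6 := h0 k
      linarith
  have hlim : Tendsto (fun n : ℕ => Real.exp (2 * L * T) * ((2 * L * T) ^ n / n.factorial)) atTop
      (𝓝 (Real.exp (2 * L * T) * 0)) :=
    (FloorSemiring.tendsto_pow_div_factorial_atTop (2 * L * T)).const_mul _
  have := ge_of_tendsto' hlim (fun n => claim n k T hT0 le_rfl)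
  rw [mul_zero] at this
  have h7 := nonpos_of_mul_nonpos_right this (Real.exp_pos _)
  linarith

end sol2

lemma per_shift {f : ℝ → ℝ} (hp : ∀ t, 0 ≤ t → f (t + 1) = f t) {s : ℝ} (hs : 0 ≤ s) :
    ∫ u in s..(s + 1), f u = ∫ u in (0:ℝ)..1, f u := by
  have hn : ∀ (n : ℕ) t, 0 ≤ t → f (t + n) = f t := by
    intro n
    induction n with
    | zero => simp
    | succ n ih =>
      intro t ht
      push_cast
      rw [← add_assoc, hp _ (by positivity), ih t ht]
  have hfr : ∀ t, 0 ≤ t → f (Int.fract t) = f t := fun t ht => by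
    have := hn ⌊t⌋₊ (Int.fract t) (Int.fract_nonneg t)
    rw [← this]
    congr 1
    have h2 : ((⌊t⌋₊ : ℕ) : ℝ) = (⌊t⌋ : ℤ) := natCast_floor_eq_intCast_floor ht
    rw [h2, Int.fract_add_floor]
  have hP : Function.Periodic (fun t => f (Int.fract t)) 1 := fun t => by simp
  have h1 := hP.intervalIntegral_add_eq s 0
  rw [zero_add] at h1
  have e1 : ∫ u in s..(s + 1), f u = ∫ u in s..(s + 1), f (Int.fract u) := by
    apply intervalIntegral.integral_congr
    intro u hu
    rw [Set.uIcc_of_le (by linarith)] at hu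
    exact (hfr u (hs.trans hu.1)).symm
  have e2 : ∫ u in (0:ℝ)..1, f u = ∫ u in (0:ℝ)..1, f (Int.fract u) := by
    apply intervalIntegral.integral_congr
    intro u hu
    rw [Set.uIcc_of_le (by linarith)] at hu
    exact (hfr u hu.1).symm
  rw [e1, e2, h1]

lemma per_lower {α : ℝ → ℝ} (hloc : LocallyIntegrableOn α (Set.Ici 0))
    (hp : ∀ t, 0 ≤ t → α (t + 1) = α t) {a K : ℝ} (ha : a = ∫ u in (0 : ℝ)..1, α u) (ha0 : 0 < a)
    (hK : K = sSup {x : ℝ | ∃ s t : ℝ, 0 ≤ s ∧ s ≤ t ∧ t ≤ s + 1 ∧ x = ∫ u in s..t, α u})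
    {s t : ℝ} (hs : 0 ≤ s) (hst : s ≤ t) : a * (t - s) - K ≤ ∫ u in s..t, α u := by
  have hii : ∀ s t, 0 ≤ s → 0 ≤ t → IntervalIntegrable α volume s t := fun s t hs ht => by
    rw [intervalIntegrable_iff]
    exact (hloc.integrableOn_compact_subset (t := Set.uIcc s t)
      (fun x hx => (le_min hs ht).trans hx.1) isCompact_uIcc).mono_set Set.uIoc_subset_uIcc
  have hbdd : BddAbove {x : ℝ | ∃ s t : ℝ, 0 ≤ s ∧ s ≤ t ∧ t ≤ s + 1 ∧ x = ∫ u in s..t, α u} := by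
    refine ⟨∫ u in (0:ℝ)..1, |α u|, ?_⟩
    rintro x ⟨s, t, hs, hst, ht, rfl⟩
    rw [← per_shift (f := fun u => |α u|) (fun t ht => by rw [hp t ht]) hs]
    have ht0 : 0 ≤ t := hs.trans hst
    calc ∫ u in s..t, α u ≤ ∫ u in s..t, |α u| :=
          intervalIntegral.integral_mono_on hst (hii s t hs ht0) (hii s t hs ht0).abs
            (fun u _ => le_abs_self _)
      _ ≤ ∫ u in s..(s + 1), |α u| := by
          have h1 := intervalIntegral.integral_add_adjacent_intervals (hii s t hs ht0).abs
            (hii t (s + 1) ht0 (by linarith)).abs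
          have h2 : 0 ≤ ∫ u in t..(s + 1), |α u| :=
            intervalIntegral.integral_nonneg ht (fun u _ => abs_nonneg _)
          linarith
  have hn : ∀ n : ℕ, ∫ u in s..(s + n), α u = n * a := by
    intro n
    induction n with
    | zero => simp
    | succ n ih =>
      have h1 := intervalIntegral.integral_add_adjacent_intervals
        (hii s (s + n) hs (by positivity)) (hii (s + n) (s + n + 1) (by positivity) (by positivity))
      rw [per_shift hp (by positivity), ih, ← ha] at h1
      push_cast
      rw [← add_assoc, ← h1]
      ring
  set n := ⌈t - s⌉₊ with hndef
  have h1 : t - s ≤ n := Nat.le_ceil _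
  have h2 : (n:ℝ) < t - s + 1 := Nat.ceil_lt_add_one (by linarith)
  have h3 : ∫ u in t..(s + n), α u ≤ K := by
    rw [hK]
    exact le_csSup hbdd ⟨t, s + n, hs.trans hst, by linarith, by linarith, rfl⟩
  have h4 := intervalIntegral.integral_add_adjacent_intervals (hii s t hs (hs.trans hst))
    (hii t (s + n) (hs.trans hst) (by positivity))
  rw [hn] at h4
  nlinarith

/-- Corollary 2, bound (cor003).  Assume all intensity functions are
`1`-periodic.  Let `a = ∫_0^1 α(t) dt > 0`, `K = sup_{0≤s≤t≤s+1} ∫_s^t α(u) du`,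
`R = e^K`, and let `F` be an essential bound of `‖f(t)‖_{1D}` where
`f(t) = (a_{10}(t), a_{20}(t), …)`.  If `π` is a `1`-periodic solution of the forward
Kolmogorov system (the limiting periodic regime, with finite `D`-norm) and `p` is the
solution with `p(0) = e_0`, then `‖π(t) − p(t)‖ ≤ (4FR/a)·e^{−at}` for all `t ≥ 0`. -/
theorem cor2_cor003
    (a : ℕ → ℕ → ℝ → ℝ) (d : ℕ → ℝ) (L : ℝ)
    (hd1 : d 1 = 1) (hdpos : ∀ k, 1 ≤ k → 0 < d k)
    (hdmono : ∀ k, 1 ≤ k → d k ≤ d (k + 1))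
    (haloc : ∀ i j, LocallyIntegrableOn (a i j) (Set.Ici 0))
    (haoff : ∀ i j, i ≠ j → ∀ t : ℝ, 0 ≤ t → 0 ≤ a i j t)
    (hadiag : ∀ j, ∀ t : ℝ, 0 ≤ t → HasSum (fun i => a i j t) 0)
    (haL : ∀ᵐ t : ℝ, 0 ≤ t → ∀ j, |a j j t| ≤ L)
    (hbstar : ∀ᵐ t : ℝ, 0 ≤ t → ∀ i j, 1 ≤ i → 1 ≤ j → i ≠ j → 0 ≤ bStar d a i j t)
    (hαfin : ∀ᵐ t : ℝ, 0 ≤ t → BddBelow (Set.range fun i : ℕ => alphaI d a (i + 1) t))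
    (hαloc : LocallyIntegrableOn (alphaInf d a) (Set.Ici 0))
    (hper : ∀ i j : ℕ, ∀ t : ℝ, 0 ≤ t → a i j (t + 1) = a i j t)
    (aInt : ℝ) (haInt : aInt = ∫ u in (0 : ℝ)..1, alphaInf d a u) (haIntPos : 0 < aInt)
    (K R : ℝ)
    (hK : K = sSup {x : ℝ | ∃ s t : ℝ, 0 ≤ s ∧ s ≤ t ∧ t ≤ s + 1 ∧
      x = ∫ u in s..t, alphaInf d a u})
    (hR : R = Real.exp K)
    (F : ℝ) (hF : ∀ᵐ t : ℝ, 0 ≤ t → norm1D d (fun i => a i 0 t) ≤ F)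
    (π : ℝ → ℕ → ℝ) (hπ : IsKolmogorovSolution a π)
    (hπper : ∀ t : ℝ, 0 ≤ t → π (t + 1) = π t)
    (hπfin : Norm1DFinite d (π 0))
    (p : ℝ → ℕ → ℝ) (hp : IsKolmogorovSolution a p)
    (hp0 : ∀ i : ℕ, p 0 i = if i = 0 then 1 else 0) :
    ∀ t : ℝ, 0 ≤ t →
      (∑' i : ℕ, |π t i - p t i|) ≤
        (4 * F * R / aInt) * Real.exp (-aInt * t) := by
  have hd : ∀ k, 0 < d (k + 1) := fun k => hdpos _ (by omega)
  have hd1' : ∀ k, 1 ≤ d (k + 1) := by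
    intro k
    induction k with
    | zero => simp [hd1]
    | succ k ih => exact ih.trans (hdmono _ (by omega))
  have hfreq : ∃ᵐ t : ℝ, t ∈ Set.Ici (0:ℝ) := by
    rw [frequently_ae_mem_iff]; simp
  have hA : ∀ᵐ t : ℝ, 0 ≤ t → ∀ i j, |a i j t| ≤ L := by
    filter_upwards [haL] with t ht h0
    exact a_abs (fun j => hadiag j t h0) (fun i j hij => haoff i j hij t h0) (ht h0)
  have hT : ∀ᵐ t : ℝ, 0 ≤ t → GoodT L (fun k j => Tm a k j t) := by
    filter_upwards [haL, hbstar] with t ht hb h0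
    exact goodT_of hdpos (fun j => hadiag j t h0) (fun i j hij => haoff i j hij t h0) (ht h0) (hb h0)
  have hL : 0 ≤ L := by
    obtain ⟨t, h1, h2⟩ := (hfreq.and_eventually hA).exists
    exact (abs_nonneg _).trans (h2 h1 0 0)
  have hF0 : 0 ≤ F := by
    obtain ⟨t, h1, h2⟩ := (hfreq.and_eventually hF).exists
    refine le_trans ?_ (h2 h1)
    exact tsum_nonneg fun k => mul_nonneg (hd k).le (abs_nonneg _)
  have hαper : ∀ t, 0 ≤ t → alphaInf d a (t + 1) = alphaInf d a t := fun t ht => by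
    simp only [alphaInf, alphaI, bStar, bEntry, hper _ _ t ht]
  have hαii : ∀ s t, 0 ≤ s → 0 ≤ t → IntervalIntegrable (alphaInf d a) volume s t :=
    fun s t hs ht => by
      rw [intervalIntegrable_iff]
      exact (hαloc.integrableOn_compact_subset (t := Set.uIcc s t)
        (fun x hx => (le_min hs ht).trans hx.1) isCompact_uIcc).mono_set Set.uIoc_subset_uIcc
  have hπp := fun t (ht : 0 ≤ t) => tl_props (hπ.1 t ht).1 (hπ.1 t ht).2
  have hpp := fun t (ht : 0 ≤ t) => tl_props (hp.1 t ht).1 (hp.1 t ht).2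
  -- the weighted norm of the periodic regime
  have hX0 : Summable (fun k => d (k + 1) * tl π (k + 1) 0) := by
    refine hπfin.congr fun k => ?_
    obtain ⟨h1, -, -, -, -, h6⟩ := hπp 0 le_rfl
    have : ∑' i, π 0 (k + 1 + i) = tl π (k + 1) 0 := by
      rw [← (h6 (k + 1)).tsum_eq]
      exact tsum_congr fun i => by rw [add_comm]
    rw [this, abs_of_nonneg (h1 _)]
  have hπn : ∀ n : ℕ, π n = π 0 := by
    intro n
    induction n with
    | zero => simp
    | succ n ih => push_cast; rw [hπper _ (Nat.cast_nonneg n), ih]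
  have htln : ∀ (n k : ℕ), tl π k n = tl π k 0 := fun n k => by unfold tl; rw [hπn]
  have hXn : ∀ n : ℕ, Summable (fun k => d (k + 1) * tl π (k + 1) n) := fun n => by
    simpa only [htln] using hX0
  have hXle : ∀ t, 0 ≤ t → ∀ k, d (k + 1) * tl π (k + 1) t ≤
      Real.exp L * (d (k + 1) * tl π (k + 1) 0) := fun t ht k => by
    have h1 := tl_grow hπ haloc hA hT (k + 1) ht (Nat.le_ceil t)
    rw [htln] at h1
    have h2 : Real.exp (L * (⌈t⌉₊ - t)) ≤ Real.exp L := by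
      apply Real.exp_le_exp.2
      have := Nat.ceil_lt_add_one ht
      nlinarith
    have h3 := (hπp 0 le_rfl).1 (k + 1)
    rw [mul_left_comm]
    exact mul_le_mul_of_nonneg_left (h1.trans (mul_le_mul_of_nonneg_right h2 h3)) (hd k).le
  have hXs : ∀ t, 0 ≤ t → Summable (fun k => d (k + 1) * tl π (k + 1) t) := fun t ht =>
    Summable.of_nonneg_of_le (fun k => mul_nonneg (hd k).le ((hπp t ht).1 _)) (hXle t ht)
      (hX0.mul_left _)
  set X0 : ℝ := ∑' k, d (k + 1) * tl π (k + 1) 0 with hX0def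
  have hXC : ∀ t, 0 ≤ t → ∑' k, d (k + 1) * tl π (k + 1) t ≤ Real.exp L * X0 := fun t ht => by
    rw [hX0def, ← tsum_mul_left]
    exact (hXs t ht).tsum_le_tsum (hXle t ht) (hX0.mul_left _)
  have hcolae := col_ae hd hπ haloc hA hT hXn
  have hpos : ∀ t, 0 ≤ t → ∀ i, 0 < tl π i t → ∃ j, i ≤ j ∧ 0 < π t j := by
    intro t ht i hi
    by_contra! hcon
    have h6 := (hπp t ht).2.2.2.2.2 i
    have : ∀ m, π t (m + i) = 0 := fun m =>
      le_antisymm (hcon _ (by omega)) ((hπ.1 t ht).1 _)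
    simp_rw [this] at h6
    exact hi.ne' (h6.unique hasSum_zero)
  have hαle : ∀ᵐ t : ℝ, 0 ≤ t → ∀ i, alphaInf d a t ≤
      -∑' k, d (k + 1) / d (i + 1) * (Tm a (k + 1) (i + 1) t - Tm a (k + 1) i t) := by
    filter_upwards [hαfin] with t ht h0 i
    rw [← alphaI_eq (fun j => hadiag j t h0)]
    exact ciInf_le (ht h0) i
  have hcol : ∀ᵐ t : ℝ, 0 ≤ t → ∀ i, 0 < tl π (i + 1) t →
      Summable (fun k => d (k + 1) / d (i + 1) * (Tm a (k + 1) (i + 1) t - Tm a (k + 1) i t)) := by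
    filter_upwards [hcolae, hT] with t h1 hg h0 i hi
    obtain ⟨j, hij, hj⟩ := hpos t h0 _ hi
    have e1 := (hg h0).col_summable hd (hπ.1 t h0).1 (h1 h0) hij hj
    have e2 := (hg h0).col_summable hd (hπ.1 t h0).1 (h1 h0) (i := i) (by omega) hj
    refine ((e1.sub e2).mul_left (d (i + 1))⁻¹).congr fun k => ?_
    ring
  have hcol0 : ∀ᵐ t : ℝ, 0 ≤ t → ∀ n, ∑ k ∈ Finset.range n, d (k + 1) * Tm a (k + 1) 0 t ≤ F := by
    filter_upwards [hcolae, hT, hF] with t h1 hg hf h0 n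
    obtain ⟨j, hij, hj⟩ := hpos t h0 0 (by rw [(hπp t h0).2.2.2.2.1]; exact one_pos)
    have e1 := (hg h0).col_summable hd (hπ.1 t h0).1 (h1 h0) hij hj
    have e0 : ∀ k, 0 ≤ Tm a (k + 1) 0 t := fun k => (hg h0).lo0 (k + 1) 0 (by omega)
    have e2 : norm1D d (fun i => a i 0 t) = ∑' k, d (k + 1) * Tm a (k + 1) 0 t := by
      unfold norm1D
      refine tsum_congr fun k => ?_
      rw [(Tm_eq (hadiag 0 t h0) (k + 1)).tsum_eq, abs_of_nonneg (e0 k)]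
    rw [e2] at hf
    exact (e1.sum_le_tsum _ (fun k _ => mul_nonneg (hd k).le (e0 k))).trans (hf h0)
  -- estimate for the periodic regime over one period
  have hper1 := main_ineq (F := F) (ζ := fun k t => tl π k t) (H := fun k t => Gf a π k t)
    (T := 1) zero_le_one hL hd (hαii 0 1 le_rfl zero_le_one)
    (fun k => Gf_ii hπ haloc hA hT k le_rfl zero_le_one)
    (fun k t h0 _ => tl_int hπ haloc hA k le_rfl h0)
    (fun k t h0 _ => (hπp t h0).1 k) (fun t h0 _ => hXs t h0) (fun t h0 _ => hXC t h0) (by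
      filter_upwards [hT, hαle, hcol, hcol0] with t hg h1 h2 h3 h0 _ n
      have e1 := (hg h0).core hd (ζ := fun k => tl π k t) ((hπp t h0).1) ((hπp t h0).2.1)
        (hXs t h0) (h2 h0) (h1 h0) n
      have e2 : ∑ k ∈ Finset.range n, d (k + 1) * Gf a π (k + 1) t =
          ∑ k ∈ Finset.range n, d (k + 1) * Tm a (k + 1) 0 t +
          ∑ k ∈ Finset.range n, d (k + 1) *
            ∑' i, (Tm a (k + 1) (i + 1) t - Tm a (k + 1) i t) * tl π (i + 1) t := by
        rw [← Finset.sum_add_distrib]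
        refine Finset.sum_congr rfl fun k _ => ?_
        rw [abelG hπ h0 (hg h0) (by omega), mul_add]
      rw [e2]
      have := h3 h0 n
      linarith)
  have htl1 : ∀ k, tl π k 1 = tl π k 0 := fun k => by simpa using htln 1 k
  simp only [htl1] at hper1
  rw [← haInt, ← hX0def] at hper1
  -- comparison
  have htp0 : ∀ k, tl p (k + 1) 0 = 0 := fun k => by
    simp [tl, hp0]
  have hcmp : ∀ k t, 0 ≤ t → tl p k t ≤ tl π k t := fun k t ht =>
    compare hp hπ haloc hA hT hL (fun k => by
      rcases k with _ | k
      · simp [tl]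
      · rw [htp0]; exact (hπp 0 le_rfl).1 _) k ht
  intro t ht
  have hvs : ∀ s, 0 ≤ s → Summable (fun k => d (k + 1) * (tl π (k + 1) s - tl p (k + 1) s)) :=
    fun s hs => Summable.of_nonneg_of_le
      (fun k => mul_nonneg (hd k).le (sub_nonneg.2 (hcmp _ s hs)))
      (fun k => mul_le_mul_of_nonneg_left (by linarith [(hpp s hs).1 (k + 1)]) (hd k).le) (hXs s hs)
  have hdiff := main_ineq (F := 0) (C := Real.exp L * X0) (ζ := fun k t => tl π k t - tl p k t)
    (H := fun k t => Gf a π k t - Gf a p k t)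
    (T := t) ht hL hd (hαii 0 t le_rfl ht)
    (fun k => (Gf_ii hπ haloc hA hT k le_rfl ht).sub (Gf_ii hp haloc hA hT k le_rfl ht))
    (fun k s h0 _ => by
      rw [intervalIntegral.integral_sub (Gf_ii hπ haloc hA hT k le_rfl h0)
            (Gf_ii hp haloc hA hT k le_rfl h0), tl_int hπ haloc hA k le_rfl h0,
            tl_int hp haloc hA k le_rfl h0]
      ring)
    (fun k s h0 _ => sub_nonneg.2 (hcmp k s h0)) (fun s h0 _ => hvs s h0)
    (fun s h0 _ => ((hvs s h0).tsum_le_tsum (fun k => mul_le_mul_of_nonneg_left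
      (by linarith [(hpp s h0).1 (k + 1)]) (hd k).le) (hXs s h0)).trans (hXC s h0)) (by
      filter_upwards [hT, hαle, hcol] with s hg h1 h2 h0 _ n
      have e1 := (hg h0).core hd (ζ := fun k => tl π k s - tl p k s)
        (fun k => sub_nonneg.2 (hcmp k s h0))
        (fun k => by linarith [(hπp s h0).2.1 k, (hpp s h0).1 k])
        (hvs s h0) (fun i hi => h2 h0 i (by linarith [(hpp s h0).1 (i + 1)])) (h1 h0) n
      have e2 : ∑ k ∈ Finset.range n, d (k + 1) * (Gf a π (k + 1) s - Gf a p (k + 1) s) =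
          ∑ k ∈ Finset.range n, d (k + 1) *
            ∑' i, (Tm a (k + 1) (i + 1) s - Tm a (k + 1) i s) *
              (tl π (i + 1) s - tl p (i + 1) s) := by
        refine Finset.sum_congr rfl fun k _ => ?_
        rw [abelG_sub hπ hp h0 (hg h0) (by omega)]
      rw [e2, zero_add]
      exact e1)
  simp only [htp0, sub_zero, zero_mul, add_zero] at hdiff
  rw [← hX0def] at hdiff
  set S : ℝ := ∑' k, d (k + 1) * (tl π (k + 1) t - tl p (k + 1) t) with hS
  set At : ℝ := ∫ u in (0:ℝ)..t, alphaInf d a u with hAt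
  -- l1 bound
  have hl1 : ∑' i, |π t i - p t i| ≤ 2 * S := by
    set v : ℕ → ℝ := fun k => tl π k t - tl p k t with hv
    have hv0 : ∀ k, 0 ≤ v k := fun k => sub_nonneg.2 (hcmp k t ht)
    have hvz : v 0 = 0 := by simp [hv, tl]
    have hsv1 : Summable (fun k => v (k + 1)) :=
      Summable.of_nonneg_of_le (fun k => hv0 _)
        (fun k => le_mul_of_one_le_left (hv0 (k + 1)) (hd1' k)) (hvs t ht)
    have hsv : Summable v := (summable_nat_add_iff 1).1 hsv1
    have hv1S : ∑' k, v (k + 1) ≤ S := hsv1.tsum_le_tsum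
      (fun k => le_mul_of_one_le_left (hv0 (k + 1)) (hd1' k)) (hvs t ht)
    have hvS : ∑' k, v k = ∑' k, v (k + 1) := by
      rw [hsv.tsum_eq_zero_add, hvz, zero_add]
    have hb : ∀ i, |π t i - p t i| ≤ v i + v (i + 1) := fun i => by
      rw [(hπp t ht).2.2.2.1 i, (hpp t ht).2.2.2.1 i, abs_le]
      have h1 := hv0 i
      have h2 := hv0 (i + 1)
      simp only [hv] at h1 h2 ⊢
      constructor <;> linarith
    have h3 : Summable (fun i => |π t i - p t i|) :=
      Summable.of_nonneg_of_le (fun i => abs_nonneg _) hb (hsv.add hsv1)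
    have h4 := h3.tsum_le_tsum hb (hsv.add hsv1)
    rw [hsv.tsum_add hsv1] at h4
    linarith
  -- exponential estimate
  have hEs : ∀ s ∈ Set.Icc (0:ℝ) 1, Real.exp (∫ u in (0:ℝ)..s, alphaInf d a u) ≤
      (Real.exp At * R * Real.exp (-aInt * t)) * Real.exp (aInt * s) := by
    intro s hs
    have h1 := per_lower hαloc hαper haInt haIntPos hK hs.1 (show s ≤ t + 1 by linarith [hs.2])
    have h2 := intervalIntegral.integral_add_adjacent_intervals (hαii 0 s le_rfl hs.1)
      (hαii s (t + 1) hs.1 (by linarith))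
    have h3 := intervalIntegral.integral_add_adjacent_intervals (hαii 0 t le_rfl ht)
      (hαii t (t + 1) ht (by linarith))
    rw [per_shift hαper ht, ← haInt, ← hAt] at h3
    rw [hR, ← Real.exp_add, ← Real.exp_add, ← Real.exp_add]
    apply Real.exp_le_exp.2
    linarith
  have hI : ∫ s in (0:ℝ)..1, Real.exp (∫ u in (0:ℝ)..s, alphaInf d a u) ≤
      (Real.exp At * R * Real.exp (-aInt * t)) * ((Real.exp aInt - 1) / aInt) := by
    have h1 : ∫ s in (0:ℝ)..1, Real.exp (aInt * s) = (Real.exp aInt - 1) / aInt := by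
      rw [intervalIntegral.integral_comp_mul_left (fun x => Real.exp x) haIntPos.ne', integral_exp]
      simp
      ring
    rw [← h1, ← intervalIntegral.integral_const_mul]
    refine intervalIntegral.integral_mono_on zero_le_one ?_ ?_ hEs
    · exact (ac_exp_comp ((hαii 0 1 le_rfl zero_le_one).absolutelyContinuousOnInterval_intervalIntegral
        (c := 0) (by simp))).continuousOn.intervalIntegrable
    · exact Continuous.intervalIntegrable (by fun_prop) _ _
  have hea : 0 < Real.exp aInt - 1 := by
    have := Real.add_one_lt_exp haIntPos.ne'
    linarith
  have hX0b : X0 ≤ F * (Real.exp At * R * Real.exp (-aInt * t)) / aInt := by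
    have h1 := mul_le_mul_of_nonneg_left hI hF0
    have h2 : X0 * (Real.exp aInt - 1) ≤
        (F * (Real.exp At * R * Real.exp (-aInt * t)) / aInt) * (Real.exp aInt - 1) := by
      calc X0 * (Real.exp aInt - 1)
          ≤ F * ∫ s in (0:ℝ)..1, Real.exp (∫ u in (0:ℝ)..s, alphaInf d a u) := by linarith
        _ ≤ _ := h1
        _ = _ := by ring
    exact le_of_mul_le_mul_right h2 hea
  have hSb : S ≤ F * R / aInt * Real.exp (-aInt * t) := by
    have h1 := hdiff.trans hX0b
    have h2 : F * (Real.exp At * R * Real.exp (-aInt * t)) / aInt =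
        Real.exp At * (F * R / aInt * Real.exp (-aInt * t)) := by ring
    rw [h2] at h1
    exact le_of_mul_le_mul_left h1 (Real.exp_pos _)
  have hR0 : 0 < R := hR ▸ Real.exp_pos K
  have hnn : 0 ≤ F * R / aInt * Real.exp (-aInt * t) := by positivity
  calc ∑' i, |π t i - p t i| ≤ 2 * S := hl1
    _ ≤ 4 * (F * R / aInt * Real.exp (-aInt * t)) := by linarith
    _ = _ := by ring
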